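/- Let d ≥ 2 and let (F1,F2,F3) be a triple of complete flags of ℂ^d in general position such that T^j(F1,F2,F3) = 1 for every j ∈ B. Let W ∈ GL_d(ℂ) be the unique unipotent matrix preserving the flag F2 with W·F1 = F3. Then the line ℓ := W^{−1}(F1^1) satisfies F2^a + F1^b + ℓ = ℂ^d for all nonnegative integers a, b with a + b = d − 1, and D^i(F2, F1, ℓ, F3^1) = 1 for every i ∈ A. -/

import Mathlib

noncomputable section

/-- A complete flag of `ℂ^d`: an increasing chain of subspaces `F 0 ⊆ F 1 ⊆ ⋯` of `ℂ^d`
with `dim (F k) = k` for all `k ≤ d`. -/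
def IsCompleteFlag (d : ℕ) (F : ℕ → Submodule ℂ (Fin d → ℂ)) : Prop :=
  Monotone F ∧ ∀ k, k ≤ d → Module.finrank ℂ ↥(F k) = k

/-- Two complete flags of `ℂ^d` are transverse: `F^k + G^(d-k) = ℂ^d` for all `k`. -/
def TransverseFlags (d : ℕ) (F G : ℕ → Submodule ℂ (Fin d → ℂ)) : Prop :=
  ∀ k, k ≤ d → F k ⊔ G (d - k) = ⊤

/-- The flag `g · F`, whose subspaces are the images `g (F k)`. -/
def flagMap (d : ℕ) (g : Matrix (Fin d) (Fin d) ℂ) (F : ℕ → Submodule ℂ (Fin d → ℂ)) :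
    ℕ → Submodule ℂ (Fin d → ℂ) :=
  fun k => Submodule.map g.mulVecLin (F k)

/-- A triple of flags of `ℂ^d` in general position:
`F1^k1 + F2^k2 + F3^k3 = ℂ^d` whenever `k1 + k2 + k3 = d`. -/
def GenPos3 (d : ℕ) (F1 F2 F3 : ℕ → Submodule ℂ (Fin d → ℂ)) : Prop :=
  ∀ k1 k2 k3 : ℕ, k1 + k2 + k3 = d → F1 k1 ⊔ F2 k2 ⊔ F3 k3 = ⊤

/-- The index set `B`: triples of positive integers summing to `d`. -/
def memB (d : ℕ) (j : ℕ × ℕ × ℕ) : Prop :=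
  0 < j.1 ∧ 0 < j.2.1 ∧ 0 < j.2.2 ∧ j.1 + j.2.1 + j.2.2 = d

/-- The index set `A`: pairs of positive integers summing to `d`. -/
def memA (d : ℕ) (i : ℕ × ℕ) : Prop :=
  0 < i.1 ∧ 0 < i.2 ∧ i.1 + i.2 = d

/-- `v 0, v 1, …, v (d-1)` is a basis adapted to the flag `F`: for every `k ≤ d`, the
subspace `F k` is spanned by the first `k` vectors.  A nonzero element `f^k` of the line
`⋀^k F^k` is then given by `v 0 ∧ ⋯ ∧ v (k-1)`. -/
def IsAdaptedBasis (d : ℕ) (F : ℕ → Submodule ℂ (Fin d → ℂ)) (v : ℕ → Fin d → ℂ) : Prop :=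
  ∀ k, k ≤ d → F k = Submodule.span ℂ (v '' {m | m < k})

/-- A choice of adapted basis for a flag. -/
noncomputable def flagBasis (d : ℕ) (F : ℕ → Submodule ℂ (Fin d → ℂ)) : ℕ → Fin d → ℂ :=
  Classical.epsilon (IsAdaptedBasis d F)

/-- The scalar `f1^a ∧ f2^b ∧ f3^(d-a-b)`: the wedge product of the first `a` vectors of
`v1`, the first `b` vectors of `v2` and the first `d - a - b` vectors of `v3`, viewed as a
complex number via the determinant (i.e. via the standard identification `⋀^d ℂ^d ≅ ℂ`). -/
noncomputable def wedgeDet (d a b : ℕ) (v1 v2 v3 : ℕ → Fin d → ℂ) : ℂ :=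
  Matrix.det (Matrix.of fun (i j : Fin d) =>
    if (i : ℕ) < a then v1 (i : ℕ) j
    else if (i : ℕ) < a + b then v2 ((i : ℕ) - a) j
    else v3 ((i : ℕ) - a - b) j)

/-- The triple ratio `T^j(F1,F2,F3)` of a triple of flags in general position,
for `j = (j1,j2,j3)` with `j1 + j2 + j3 = d`. -/
noncomputable def tripleRatio (d : ℕ) (j : ℕ × ℕ × ℕ)
    (F1 F2 F3 : ℕ → Submodule ℂ (Fin d → ℂ)) : ℂ :=
  (wedgeDet d (j.1 + 1) j.2.1 (flagBasis d F1) (flagBasis d F2) (flagBasis d F3) *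
      wedgeDet d j.1 (j.2.1 - 1) (flagBasis d F1) (flagBasis d F2) (flagBasis d F3) *
      wedgeDet d (j.1 - 1) (j.2.1 + 1) (flagBasis d F1) (flagBasis d F2) (flagBasis d F3)) /
    (wedgeDet d (j.1 - 1) j.2.1 (flagBasis d F1) (flagBasis d F2) (flagBasis d F3) *
      wedgeDet d j.1 (j.2.1 + 1) (flagBasis d F1) (flagBasis d F2) (flagBasis d F3) *
      wedgeDet d (j.1 + 1) (j.2.1 - 1) (flagBasis d F1) (flagBasis d F2) (flagBasis d F3))

/-- A choice of nonzero vector in a (1-dimensional) subspace. -/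
noncomputable def lineVec (d : ℕ) (l : Submodule ℂ (Fin d → ℂ)) : Fin d → ℂ :=
  Classical.epsilon fun v => v ∈ l ∧ v ≠ 0

/-- The double ratio `D^i(G1,G2,ℓ1,ℓ2)` of a pair of transverse flags and a pair of lines,
for `i = (i1,i2)` with `i1 + i2 = d`. -/
noncomputable def doubleRatioLine (d : ℕ) (i : ℕ × ℕ) (G1 G2 : ℕ → Submodule ℂ (Fin d → ℂ))
    (l1 l2 : Submodule ℂ (Fin d → ℂ)) : ℂ :=
  -((wedgeDet d i.1 (i.2 - 1) (flagBasis d G1) (flagBasis d G2) (fun _ => lineVec d l1) *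
        wedgeDet d (i.1 - 1) i.2 (flagBasis d G1) (flagBasis d G2) (fun _ => lineVec d l2)) /
      (wedgeDet d i.1 (i.2 - 1) (flagBasis d G1) (flagBasis d G2) (fun _ => lineVec d l2) *
        wedgeDet d (i.1 - 1) i.2 (flagBasis d G1) (flagBasis d G2) (fun _ => lineVec d l1)))

/-- The double ratio `D^i(G1,G2,H1,H2)` of four flags, which only depends on the
`1`-dimensional parts of `H1` and `H2`. -/
noncomputable def doubleRatio (d : ℕ) (i : ℕ × ℕ)
    (G1 G2 H1 H2 : ℕ → Submodule ℂ (Fin d → ℂ)) : ℂ :=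
  doubleRatioLine d i G1 G2 (H1 1) (H2 1)

/-- Triangular change of rows multiplies the determinant by the diagonal product. -/
lemma det_tri {d : ℕ} (r r' : Fin d → Fin d → ℂ) (t : Fin d → ℂ)
    (h : ∀ i, r' i - t i • r i ∈ Submodule.span ℂ (r '' {j | j < i})) :
    Matrix.det (Matrix.of r') = (∏ i, t i) * Matrix.det (Matrix.of r) := by
  have h' : ∀ i, ∃ c : Fin d → ℂ, (∀ j, ¬ j < i → c j = 0) ∧
      r' i - t i • r i = ∑ j, c j • r j := by
    intro i
    have hi := h i
    rw [Finsupp.mem_span_image_iff_linearCombination] at hi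
    obtain ⟨l, hl, he⟩ := hi
    refine ⟨l, ?_, ?_⟩
    · intro j hj
      by_contra hne
      exact hj (hl (by simpa using hne))
    · rw [← he, Finsupp.linearCombination_apply, Finsupp.sum_fintype]
      simp
  choose c hc hr using h'
  let N : Matrix (Fin d) (Fin d) ℂ := Matrix.of fun i j => (if i = j then t i else 0) + c i j
  have hN : Matrix.of r' = N * Matrix.of r := by
    ext i j
    have := congrFun (hr i) j
    simp only [Pi.sub_apply, Pi.smul_apply, smul_eq_mul, Finset.sum_apply] at this
    rw [Matrix.mul_apply]
    simp only [N, Matrix.of_apply, add_mul, Finset.sum_add_distrib, ite_mul, zero_mul,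
      Finset.sum_ite_eq, Finset.mem_univ, if_true]
    rw [← this]; ring
  rw [hN, Matrix.det_mul, Matrix.det_of_isLowerTriangular N]
  · congr 1
    apply Finset.prod_congr rfl
    intro i _
    simp [N, hc i i (lt_irrefl i)]
  · intro i j hij
    have hij' : i < j := hij
    simp [N, hc i j (not_lt.mpr hij'.le), hij'.ne]

lemma prod_three (a b c : ℕ) (t1 t2 t3 : ℕ → ℂ) :
    (∏ i ∈ Finset.range (a + b + c), (if i < a then t1 i else if i < a + b then t2 (i - a)
      else t3 (i - a - b))) =
    (∏ i ∈ Finset.range a, t1 i) * (∏ i ∈ Finset.range b, t2 i) * ∏ i ∈ Finset.range c, t3 i := by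
  rw [Finset.prod_range_add, Finset.prod_range_add]
  congr 1
  · congr 1
    · apply Finset.prod_congr rfl
      intro i hi
      rw [if_pos (Finset.mem_range.mp hi)]
    · apply Finset.prod_congr rfl
      intro i hi
      have := Finset.mem_range.mp hi
      rw [if_neg (by omega), if_pos (by omega)]
      congr 1; omega
  · apply Finset.prod_congr rfl
    intro i hi
    rw [if_neg (by omega), if_neg (by omega)]
    congr 1; omega

lemma wedge_tri {d a b c : ℕ} (hd : a + b + c = d) (v1 v2 v3 v1' v2' v3' : ℕ → Fin d → ℂ)
    (t1 t2 t3 : ℕ → ℂ)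
    (h1 : ∀ k < a, v1' k - t1 k • v1 k ∈ Submodule.span ℂ (v1 '' {m | m < k}))
    (h2 : ∀ k < b, v2' k - t2 k • v2 k ∈ Submodule.span ℂ (v2 '' {m | m < k}))
    (h3 : ∀ k < c, v3' k - t3 k • v3 k ∈ Submodule.span ℂ (v3 '' {m | m < k})) :
    wedgeDet d a b v1' v2' v3' =
      (∏ i ∈ Finset.range a, t1 i) * (∏ i ∈ Finset.range b, t2 i) *
        (∏ i ∈ Finset.range c, t3 i) * wedgeDet d a b v1 v2 v3 := by
  let R : (ℕ → Fin d → ℂ) → (ℕ → Fin d → ℂ) → (ℕ → Fin d → ℂ) → Fin d → Fin d → ℂ :=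
    fun v1 v2 v3 i => if (i : ℕ) < a then v1 i else if (i : ℕ) < a + b then v2 ((i : ℕ) - a)
      else v3 ((i : ℕ) - a - b)
  have hR : ∀ v1 v2 v3, wedgeDet d a b v1 v2 v3 = Matrix.det (Matrix.of (R v1 v2 v3)) := by
    intro v1 v2 v3
    unfold wedgeDet
    congr 1
    ext i j
    simp only [R, Matrix.of_apply]
    split_ifs <;> rfl
  rw [hR, hR, ← prod_three, hd, ← Fin.prod_univ_eq_prod_range
    (fun i => if i < a then t1 i else if i < a + b then t2 (i - a) else t3 (i - a - b))]
  apply det_tri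
  intro i
  have hi := i.2
  by_cases c1 : (i : ℕ) < a
  · simp only [R, c1, if_true]
    refine Submodule.span_mono ?_ (h1 i c1)
    rintro _ ⟨m, hm, rfl⟩
    have hm' : m < (i : ℕ) := hm
    refine ⟨⟨m, by omega⟩, ?_, ?_⟩
    · exact hm'
    · simp only []
      rw [if_pos (by omega)]
  by_cases c2 : (i : ℕ) < a + b
  · simp only [R, c1, c2, if_true, if_false]
    refine Submodule.span_mono ?_ (h2 (i - a) (by omega))
    rintro _ ⟨m, hm, rfl⟩
    have hm' : m < (i : ℕ) - a := hm
    refine ⟨⟨a + m, by omega⟩, ?_, ?_⟩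
    · show a + m < (i : ℕ)
      omega
    · simp only []
      rw [if_neg (by omega), if_pos (by omega)]
      congr 1; omega
  · simp only [R, c1, c2, if_false]
    refine Submodule.span_mono ?_ (h3 (i - a - b) (by omega))
    rintro _ ⟨m, hm, rfl⟩
    have hm' : m < (i : ℕ) - a - b := hm
    refine ⟨⟨a + b + m, by omega⟩, ?_, ?_⟩
    · show a + b + m < (i : ℕ)
      omega
    · simp only []
      rw [if_neg (by omega), if_neg (by omega)]
      congr 1; omega

lemma wedge_congr {d a b : ℕ} (a' b' : ℕ) (v1 v2 v3 u1 u2 u3 : ℕ → Fin d → ℂ)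
    (h : ∀ i < d, (if i < a then v1 i else if i < a + b then v2 (i - a) else v3 (i - a - b)) =
      (if i < a' then u1 i else if i < a' + b' then u2 (i - a') else u3 (i - a' - b'))) :
    wedgeDet d a b v1 v2 v3 = wedgeDet d a' b' u1 u2 u3 := by
  unfold wedgeDet
  congr 1
  ext i j
  have := congrFun (h i i.2) j
  simp only [Matrix.of_apply]
  split_ifs at this ⊢ <;> exact this

lemma wedge_swap {d a b : ℕ} (h : a + b ≤ d) (v1 v2 v3 : ℕ → Fin d → ℂ) :
    wedgeDet d b a v2 v1 v3 = (-1) ^ (a * b) * wedgeDet d a b v1 v2 v3 := by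
  by_cases h0 : a + b = 0
  · have ha : a = 0 := by omega
    have hb : b = 0 := by omega
    subst ha hb
    simp [wedgeDet]
  let k : Fin d := ⟨a + b - 1, by omega⟩
  have hcyc : ∀ i : Fin d, ((Fin.cycleRange k i : Fin d) : ℕ) =
      if (i : ℕ) < a + b then ((i : ℕ) + 1) % (a + b) else i := by
    intro i
    split_ifs with hi
    · by_cases hik : (i : ℕ) = a + b - 1
      · have : i = k := Fin.ext hik
        subst this
        have : NeZero d := ⟨by omega⟩
        rw [Fin.cycleRange_self, hik]
        rw [show a + b - 1 + 1 = a + b by omega]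
        simp
      · rw [Fin.coe_cycleRange_of_lt (show i < k from by show (i : ℕ) < a + b - 1; omega),
          Nat.mod_eq_of_lt (by omega)]
    · rw [Fin.cycleRange_of_gt (show k < i from by show a + b - 1 < (i : ℕ); omega)]
  have hpow : ∀ (n : ℕ) (i : Fin d), (((Fin.cycleRange k ^ n : Equiv.Perm (Fin d)) i : Fin d) : ℕ) =
      if (i : ℕ) < a + b then ((i : ℕ) + n) % (a + b) else i := by
    intro n i
    induction n with
    | zero =>
      split_ifs with hi
      · simp [Nat.mod_eq_of_lt hi]
      · simp
    | succ n ih =>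
      rw [pow_succ', Equiv.Perm.mul_apply, hcyc, ih]
      by_cases hi : (i : ℕ) < a + b
      · simp only [hi, if_true]
        rw [if_pos (Nat.mod_lt _ (by omega))]
        rw [Nat.mod_add_mod, add_assoc]
      · simp only [hi, if_false]
  have hs : (((Equiv.Perm.sign (Fin.cycleRange k ^ a) : ℤˣ) : ℤ) : ℂ) = (-1) ^ (a * b) := by
    rw [map_pow, Fin.sign_cycleRange]
    push_cast
    rw [← pow_mul]
    show (-1 : ℂ) ^ ((a + b - 1) * a) = _
    rcases Nat.even_or_odd a with ha | ha
    · rw [Even.neg_one_pow (ha.mul_left _), Even.neg_one_pow (ha.mul_right _)]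
    · obtain ⟨r, hr⟩ := ha
      have : (a + b - 1) * a = a * b + 2 * (r * a) := by
        rw [show a + b - 1 = b + 2 * r by omega]; ring
      rw [this, pow_add, pow_mul]; simp
  rw [← hs]
  unfold wedgeDet
  rw [← Matrix.det_permute]
  congr 1
  ext i j
  simp only [Matrix.of_apply, Matrix.submatrix_apply, id, hpow a i]
  have hi := i.2
  by_cases c1 : (i : ℕ) < b
  · rw [if_pos c1, if_pos (by omega : (i : ℕ) < a + b), Nat.mod_eq_of_lt (by omega),
      if_neg (by omega), if_pos (by omega)]
    congr 1; omega
  by_cases c2 : (i : ℕ) < a + b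
  · have : ((i : ℕ) + a) % (a + b) = i - b := by
      rw [show (i : ℕ) + a = (i - b) + (a + b) by omega, Nat.add_mod_right,
        Nat.mod_eq_of_lt (by omega)]
    rw [if_neg c1, if_pos (by omega), if_pos c2, this, if_pos (by omega)]
  · rw [if_neg c1, if_neg (by omega), if_neg c2, if_neg (by omega), if_neg (by omega)]
    congr 1; omega

lemma wedge_mul {d a b : ℕ} (W : Matrix (Fin d) (Fin d) ℂ) (v1 v2 v3 : ℕ → Fin d → ℂ) :
    wedgeDet d a b (fun k => W.mulVec (v1 k)) (fun k => W.mulVec (v2 k))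
      (fun k => W.mulVec (v3 k)) = wedgeDet d a b v1 v2 v3 * W.det := by
  unfold wedgeDet
  rw [← Matrix.det_transpose W, ← Matrix.det_mul]
  congr 1
  ext i j
  simp only [Matrix.of_apply, Matrix.mul_apply, Matrix.transpose_apply, Matrix.mulVec, dotProduct]
  split_ifs <;> exact Finset.sum_congr rfl fun _ _ => mul_comm _ _

lemma exists_adapted {d : ℕ} {F : ℕ → Submodule ℂ (Fin d → ℂ)} (hF : IsCompleteFlag d F) :
    ∃ v, IsAdaptedBasis d F v := by
  obtain ⟨hm, hf⟩ := hF
  have hex : ∀ k, ∃ v : Fin d → ℂ, k < d → v ∈ F (k + 1) ∧ v ∉ F k := by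
    intro k
    by_cases hk : k < d
    · have hlt : F k < F (k + 1) := by
        refine lt_of_le_of_ne (hm (Nat.le_succ k)) ?_
        intro he
        have e1 := hf k hk.le
        have e2 := hf (k + 1) hk
        rw [← he] at e2
        omega
      obtain ⟨v, hv, hv'⟩ := SetLike.exists_of_lt hlt
      exact ⟨v, fun _ => ⟨hv, hv'⟩⟩
    · exact ⟨0, fun h => absurd h hk⟩
  choose v hv using hex
  refine ⟨v, ?_⟩
  intro k
  induction k with
  | zero =>
    intro h
    have := hf 0 h
    rw [Submodule.finrank_eq_zero] at this
    simp [this]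
  | succ k ih =>
    intro hk
    have ih' := ih (by omega)
    obtain ⟨q1, q2⟩ := hv k (by omega)
    symm
    apply Submodule.eq_of_le_of_finrank_le
    · rw [Submodule.span_le]
      rintro _ ⟨m, hm', rfl⟩
      have hm'' : m < k + 1 := hm'
      exact hm (show m + 1 ≤ k + 1 by omega) (hv m (by omega)).1
    · rw [hf (k + 1) hk]
      have hlt : F k < Submodule.span ℂ (v '' {m | m < k + 1}) := by
        refine lt_of_le_of_ne ?_ ?_
        · rw [ih']
          apply Submodule.span_mono
          apply Set.image_mono
          intro m hm'
          exact Nat.lt_succ_of_lt hm'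
        · intro he
          apply q2
          rw [he]
          exact Submodule.subset_span ⟨k, Nat.lt_succ_self k, rfl⟩
      have := Submodule.finrank_lt_finrank_of_lt hlt
      rw [hf k (by omega)] at this
      omega

lemma flagBasis_adapted {d : ℕ} {F : ℕ → Submodule ℂ (Fin d → ℂ)} (hF : IsCompleteFlag d F) :
    IsAdaptedBasis d F (flagBasis d F) :=
  Classical.epsilon_spec (exists_adapted hF)

lemma wedge_ne_zero {d a b c : ℕ} (hd : a + b + c = d) {F1 F2 F3 : ℕ → Submodule ℂ (Fin d → ℂ)}
    {v1 v2 v3 : ℕ → Fin d → ℂ}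
    (h1 : IsAdaptedBasis d F1 v1) (h2 : IsAdaptedBasis d F2 v2) (h3 : IsAdaptedBasis d F3 v3)
    (ht : F1 a ⊔ F2 b ⊔ F3 c = ⊤) : wedgeDet d a b v1 v2 v3 ≠ 0 := by
  let R : Fin d → Fin d → ℂ :=
    fun i => if (i : ℕ) < a then v1 i else if (i : ℕ) < a + b then v2 ((i : ℕ) - a)
      else v3 ((i : ℕ) - a - b)
  have hR : wedgeDet d a b v1 v2 v3 = Matrix.det (Matrix.of R) := by
    unfold wedgeDet
    congr 1
    ext i j
    simp only [R, Matrix.of_apply]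
    split_ifs <;> rfl
  have hspan : ⊤ ≤ Submodule.span ℂ (Set.range R) := by
    rw [← ht, h1 a (by omega), h2 b (by omega), h3 c (by omega)]
    refine sup_le (sup_le ?_ ?_) ?_ <;> apply Submodule.span_mono <;> rintro _ ⟨m, hm, rfl⟩
    · have hm' : m < a := hm
      exact ⟨⟨m, by omega⟩, by simp only [R]; rw [if_pos (by omega)]⟩
    · have hm' : m < b := hm
      refine ⟨⟨a + m, by omega⟩, ?_⟩
      simp only [R]; rw [if_neg (by omega), if_pos (by omega)]
      congr 1; omega
    · have hm' : m < c := hm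
      refine ⟨⟨a + b + m, by omega⟩, ?_⟩
      simp only [R]; rw [if_neg (by omega), if_neg (by omega)]
      congr 1; omega
  have hli : LinearIndependent ℂ R := linearIndependent_of_top_le_span_of_card_eq_finrank hspan (by simp)
  rw [hR]
  have hu : IsUnit (Matrix.of R) := Matrix.linearIndependent_rows_iff_isUnit.mp hli
  exact ((Matrix.isUnit_iff_isUnit_det _).mp hu).ne_zero

lemma algebra_core {d b m : ℕ} (hd : b + 1 + m = d) (hm : 0 < m) (X : ℕ → ℕ → ℂ) (δ : ℂ) (hδ : δ ≠ 0)
    (hX : ∀ a b, a + b ≤ d → X a b ≠ 0)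
    (hrel : ∀ a b, a + b + 3 ≤ d → X (a + 2) (b + 1) * X (a + 1) b * X a (b + 2) =
      X a (b + 1) * X (a + 1) (b + 2) * X (a + 2) b)
    (hsym : ∀ b m, b + m = d → X 0 b = δ * (-1) ^ (b * m) * X m b) :
    X 1 (b + 1) * X m b = (-1) ^ (d - 1) * (X (m - 1) (b + 1) * X 1 b) := by
  have key : ∀ n, n + 1 ≤ m → X (n + 1) (b + 1) * X n (b + 1) * X 1 b * X 0 (b + 2) =
      X (n + 1) b * X n (b + 2) * X 1 (b + 1) * X 0 (b + 1) := by
    intro n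
    induction n with
    | zero => intro _; ring
    | succ n ih =>
      intro hn
      have i1 := ih (by omega)
      have i2 := hrel n b (by omega)
      have n1 := hX n (b + 1) (by omega)
      have n2 := hX (n + 1) b (by omega)
      have n3 := hX n (b + 2) (by omega)
      apply mul_left_cancel₀ (mul_ne_zero (mul_ne_zero n1 n2) n3)
      linear_combination (X (n + 1) (b + 1) * X 1 b * X 0 (b + 2) * X n (b + 1)) * i2 +
        X n (b + 1) * X (n + 1) (b + 2) * X (n + 2) b * i1
  obtain ⟨n, rfl⟩ : ∃ n, m = n + 1 := ⟨m - 1, by omega⟩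
  have k := key n le_rfl
  rw [hsym (b + 1) (n + 1) hd, hsym (b + 2) n (by omega)] at k
  have n1 := hX (n + 1) (b + 1) (by omega)
  have n2 := hX n (b + 2) (by omega)
  have e1 : X n (b + 1) * X 1 b * (-1) ^ ((b + 2) * n) =
      X (n + 1) b * X 1 (b + 1) * (-1) ^ ((b + 1) * (n + 1)) := by
    apply mul_left_cancel₀ (mul_ne_zero (mul_ne_zero n1 n2) hδ)
    linear_combination k
  simp only [Nat.add_sub_cancel]
  have hs : ((-1 : ℂ) ^ ((b + 1) * (n + 1))) * (-1) ^ ((b + 1) * (n + 1)) = 1 := by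
    rw [← mul_pow]; simp
  have hs2 : ((-1 : ℂ) ^ ((b + 2) * n)) * (-1) ^ ((b + 1) * (n + 1)) = (-1) ^ (d - 1) := by
    rw [← pow_add, show (b + 2) * n + (b + 1) * (n + 1) = (d - 1) + 2 * (b * n + n) by
      rw [← hd, show b + 1 + (n + 1) - 1 = b + n + 1 by omega]; ring, pow_add, pow_mul]
    simp
  linear_combination (-(X (n + 1) b * X 1 (b + 1))) * hs - (-1) ^ ((b + 1) * (n + 1)) * e1 +
    X n (b + 1) * X 1 b * hs2

lemma adapted_step {d : ℕ} {F : ℕ → Submodule ℂ (Fin d → ℂ)} {v : ℕ → Fin d → ℂ}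
    (hv : IsAdaptedBasis d F v) {k : ℕ} (hk : k < d) {x : Fin d → ℂ} (hx : x ∈ F (k + 1)) :
    ∃ t : ℂ, x - t • v k ∈ F k := by
  rw [hv (k + 1) hk] at hx
  have hset : v '' {m | m < k + 1} = insert (v k) (v '' {m | m < k}) := by
    rw [← Set.image_insert_eq]
    congr 1
    ext m
    simp only [Set.mem_setOf_eq, Set.mem_insert_iff]
    omega
  rw [hset, Submodule.mem_span_insert] at hx
  obtain ⟨t, z, hz, rfl⟩ := hx
  refine ⟨t, ?_⟩
  rw [hv k hk.le]
  simpa using hz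

lemma adapted_mem {d : ℕ} {F : ℕ → Submodule ℂ (Fin d → ℂ)} {v : ℕ → Fin d → ℂ}
    (hv : IsAdaptedBasis d F v) {k : ℕ} (hk : k < d) : v k ∈ F (k + 1) := by
  rw [hv (k + 1) hk]
  exact Submodule.subset_span ⟨k, Nat.lt_succ_self k, rfl⟩

lemma adapted_not_mem {d : ℕ} {F : ℕ → Submodule ℂ (Fin d → ℂ)} {v : ℕ → Fin d → ℂ}
    (hF : IsCompleteFlag d F) (hv : IsAdaptedBasis d F v) {k : ℕ} (hk : k < d) : v k ∉ F k := by
  intro hmem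
  have hle : F (k + 1) ≤ F k := by
    intro x hx
    obtain ⟨t, ht⟩ := adapted_step hv hk hx
    have := (F k).add_mem ht ((F k).smul_mem t hmem)
    simpa using this
  have := Submodule.finrank_mono hle
  rw [hF.2 _ hk, hF.2 _ hk.le] at this
  omega

lemma unipotent_step {d : ℕ} {F : ℕ → Submodule ℂ (Fin d → ℂ)} {v : ℕ → Fin d → ℂ}
    (hF : IsCompleteFlag d F) (hv : IsAdaptedBasis d F v) (W : Matrix (Fin d) (Fin d) ℂ)
    (hW : IsNilpotent (W - 1)) (hWF : flagMap d W F = F) {k : ℕ} (hk : k < d) :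
    W.mulVec (v k) - (1 : ℂ) • v k ∈ F k := by
  have hpres : ∀ k x, x ∈ F k → W.mulVec x ∈ F k := by
    intro k x hx
    rw [← congrFun hWF k]
    exact ⟨x, hx, rfl⟩
  obtain ⟨t, ht⟩ := adapted_step hv hk (hpres _ _ (adapted_mem hv hk))
  have hpow : ∀ n : ℕ, ((W - 1) ^ n).mulVec (v k) - (t - 1) ^ n • v k ∈ F k := by
    intro n
    induction n with
    | zero => simp
    | succ n ih =>
      have e1 := (F k).sub_mem (hpres _ _ ih) ih
      have e2 := (F k).add_mem e1 ((F k).smul_mem ((t - 1) ^ n) ht)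
      convert e2 using 1
      rw [pow_succ' (W - 1), ← Matrix.mulVec_mulVec, Matrix.sub_mulVec, Matrix.one_mulVec,
        Matrix.mulVec_sub, Matrix.mulVec_smul]
      module
  obtain ⟨n, hn⟩ := hW
  have h := hpow n
  rw [hn] at h
  have ht1 : t = 1 := by
    by_contra hne
    have hne' : (t - 1) ^ n ≠ 0 := pow_ne_zero _ (sub_ne_zero.mpr hne)
    apply adapted_not_mem hF hv hk
    have h2 := (F k).smul_mem (-((t - 1) ^ n)⁻¹) h
    convert h2 using 1
    simp [smul_smul, hne']
  rw [ht1] at ht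
  exact ht

theorem statement_12 (d : ℕ) (hd : 2 ≤ d) (F1 F2 F3 : ℕ → Submodule ℂ (Fin d → ℂ))
    (h1 : IsCompleteFlag d F1) (h2 : IsCompleteFlag d F2) (h3 : IsCompleteFlag d F3)
    (hgen : GenPos3 d F1 F2 F3)
    (hT : ∀ j : ℕ × ℕ × ℕ, memB d j → tripleRatio d j F1 F2 F3 = 1)
    (W : Matrix (Fin d) (Fin d) ℂ) (hWnil : IsNilpotent (W - 1))
    (hWF2 : flagMap d W F2 = F2) (hWF1 : flagMap d W F1 = F3) :
    (∀ a b : ℕ, a + b = d - 1 →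
        F2 a ⊔ F1 b ⊔ Submodule.comap W.mulVecLin (F1 1) = ⊤) ∧
    ∀ i : ℕ × ℕ, memA d i →
      doubleRatioLine d i F2 F1 (Submodule.comap W.mulVecLin (F1 1)) (F3 1) = 1 := by
  have hdet : W.det ≠ 0 := by
    have hu : IsUnit W := by
      have := hWnil.isUnit_add_one
      simpa using this
    exact ((Matrix.isUnit_iff_isUnit_det _).mp hu).ne_zero
  have hinj : Function.Injective W.mulVecLin := by
    apply Matrix.mulVec_injective_of_isUnit
    exact (Matrix.isUnit_iff_isUnit_det _).mpr (isUnit_iff_ne_zero.mpr hdet)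
  have hsurj : Function.Surjective W.mulVecLin := LinearMap.injective_iff_surjective.mp hinj
  constructor
  · intro a b hab
    apply Submodule.map_injective_of_injective hinj
    rw [Submodule.map_sup, Submodule.map_sup, Submodule.map_comap_eq_of_surjective hsurj,
      Submodule.map_top, LinearMap.range_eq_top.mpr hsurj]
    have e1 : Submodule.map W.mulVecLin (F2 a) = F2 a := congrFun hWF2 a
    have e2 : Submodule.map W.mulVecLin (F1 b) = F3 b := congrFun hWF1 b
    rw [e1, e2, ← hgen 1 a b (by omega), sup_comm, sup_assoc]
  have b1 := flagBasis_adapted h1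
  have b2 := flagBasis_adapted h2
  have b3 := flagBasis_adapted h3
  unfold tripleRatio at hT
  unfold doubleRatioLine
  generalize flagBasis d F1 = v1 at *
  generalize flagBasis d F2 = v2 at *
  generalize flagBasis d F3 = v3 at *
  set w : ℕ → Fin d → ℂ := fun k => W.mulVec (v1 k) with hw
  have bw : IsAdaptedBasis d F3 w := by
    intro k hk
    rw [← congrFun hWF1 k]
    show Submodule.map W.mulVecLin (F1 k) = _
    rw [b1 k hk, Submodule.map_span, ← Set.image_comp]
    rfl
  have htr2 : ∀ k < d, W.mulVec (v2 k) - (1 : ℂ) • v2 k ∈ Submodule.span ℂ (v2 '' {m | m < k}) := by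
    intro k hk
    rw [← b2 k hk.le]
    exact unipotent_step h2 b2 W hWnil hWF2 hk
  have hself : ∀ (v : ℕ → Fin d → ℂ) (k : ℕ),
      v k - (1 : ℂ) • v k ∈ Submodule.span ℂ (v '' {m | m < k}) := by
    intro v k; simp
  have htr3 : ∀ k, ∃ t : ℂ, k < d → v3 k - t • w k ∈ Submodule.span ℂ (w '' {m | m < k}) := by
    intro k
    by_cases hk : k < d
    · obtain ⟨t, ht⟩ := adapted_step bw hk (adapted_mem b3 hk)
      rw [bw k hk.le] at ht
      exact ⟨t, fun _ => ht⟩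
    · exact ⟨0, fun h => absurd h hk⟩
  choose t ht using htr3
  set X : ℕ → ℕ → ℂ := fun a b => wedgeDet d a b v1 v2 w with hXdef
  set K : ℕ → ℂ := fun c => ∏ i ∈ Finset.range c, t i with hK
  have hx3 : ∀ a b c, a + b + c = d → wedgeDet d a b v1 v2 v3 = K c * X a b := by
    intro a b c habc
    have := wedge_tri habc v1 v2 w v1 v2 v3 (fun _ => 1) (fun _ => 1) t
      (fun k _ => hself v1 k) (fun k _ => hself v2 k) (fun k hk => ht k (by omega))
    simpa using this
  have hX : ∀ a b, a + b ≤ d → X a b ≠ 0 := by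
    intro a b hab
    have e : a + b + (d - a - b) = d := by omega
    exact wedge_ne_zero e b1 b2 bw (hgen _ _ _ e)
  have hK0 : ∀ c ≤ d, K c ≠ 0 := by
    intro c hc
    have e : (d - c) + 0 + c = d := by omega
    have := wedge_ne_zero e b1 b2 b3 (hgen _ _ _ e)
    rw [hx3 _ _ _ e] at this
    exact left_ne_zero_of_mul this
  have hrel : ∀ a b, a + b + 3 ≤ d → X (a + 2) (b + 1) * X (a + 1) b * X a (b + 2) =
      X a (b + 1) * X (a + 1) (b + 2) * X (a + 2) b := by
    intro a b hab
    obtain ⟨c, hc⟩ : ∃ c, d = a + b + c + 3 := ⟨d - (a + b + 3), by omega⟩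
    have h := hT (a + 1, b + 1, c + 1) ⟨by simp, by simp, by simp, by simp only []; omega⟩
    simp only [Nat.add_sub_cancel, add_assoc, Nat.reduceAdd] at h
    rw [hx3 (a + 2) (b + 1) c (by omega), hx3 (a + 1) b (c + 2) (by omega),
      hx3 a (b + 2) (c + 1) (by omega), hx3 a (b + 1) (c + 2) (by omega),
      hx3 (a + 1) (b + 2) c (by omega), hx3 (a + 2) b (c + 1) (by omega)] at h
    have n0 := hK0 c (by omega)
    have n1 := hK0 (c + 1) (by omega)
    have n2 := hK0 (c + 2) (by omega)
    have m1 := hX a (b + 1) (by omega)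
    have m2 := hX (a + 1) (b + 2) (by omega)
    have m3 := hX (a + 2) b (by omega)
    rw [div_eq_one_iff_eq (by positivity)] at h
    apply mul_left_cancel₀ (mul_ne_zero (mul_ne_zero n0 n1) n2)
    linear_combination h
  have hsym : ∀ b m, b + m = d → X 0 b = W.det * (-1) ^ (b * m) * X m b := by
    intro b m hbm
    have s1 := wedge_mul (a := b) (b := m) W v2 v1 v1
    have s2 := wedge_tri (a := b) (b := m) (c := 0) (by omega) v2 w w
      (fun k => W.mulVec (v2 k)) w w (fun _ => 1) (fun _ => 1) (fun _ => 1)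
      (fun k hk => htr2 k (by omega)) (fun k _ => hself w k) (fun k _ => hself w k)
    have s3 := wedge_swap (a := m) (b := b) (by omega) v1 v2 v1
    have s4 : wedgeDet d b m v2 w w = X 0 b := by
      apply wedge_congr
      intro i hi
      simp only [Nat.not_lt_zero, if_false, zero_add, Nat.sub_zero]
      by_cases c1 : i < b
      · simp [c1]
      · rw [if_neg c1, if_neg c1, if_pos (by omega)]
    have s5 : wedgeDet d m b v1 v2 v1 = X m b := by
      apply wedge_congr
      intro i hi
      by_cases c1 : i < m
      · simp [c1]
      · rw [if_neg c1, if_neg c1, if_pos (by omega), if_pos (by omega)]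
    rw [← hw] at s1
    simp only [Finset.prod_const_one, one_mul] at s2
    rw [← s4, ← s2, s1, s3, s5, mul_comm m b]
    ring
  -- the two lines
  have hl1 : ∃ x, x ∈ Submodule.comap W.mulVecLin (F1 1) ∧ x ≠ 0 := by
    obtain ⟨x, hx⟩ := hsurj (v1 0)
    refine ⟨x, ?_, ?_⟩
    · rw [Submodule.mem_comap, hx]
      exact adapted_mem b1 (by omega)
    · rintro rfl
      apply adapted_not_mem h1 b1 (k := 0) (by omega)
      rw [← hx]
      simp
  have hl2 : ∃ x, x ∈ F3 1 ∧ x ≠ 0 := by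
    refine ⟨w 0, adapted_mem bw (by omega), ?_⟩
    intro h0
    apply adapted_not_mem h3 bw (k := 0) (by omega)
    rw [h0]; simp
  have p1 : lineVec d (Submodule.comap W.mulVecLin (F1 1)) ∈ Submodule.comap W.mulVecLin (F1 1) ∧
      lineVec d (Submodule.comap W.mulVecLin (F1 1)) ≠ 0 := Classical.epsilon_spec hl1
  have p2 : lineVec d (F3 1) ∈ F3 1 ∧ lineVec d (F3 1) ≠ 0 := Classical.epsilon_spec hl2
  generalize lineVec d (Submodule.comap W.mulVecLin (F1 1)) = l1 at *
  generalize lineVec d (F3 1) = l2 at *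
  obtain ⟨c1, hc1⟩ := adapted_step b1 (k := 0) (by omega) p1.1
  obtain ⟨c2, hc2⟩ := adapted_step bw (k := 0) (by omega) p2.1
  have hc1' : W.mulVec l1 - c1 • v1 0 = 0 := by
    rw [b1 0 (by omega)] at hc1
    simpa using hc1
  have hc2' : l2 - c2 • w 0 = 0 := by
    rw [bw 0 (by omega)] at hc2
    simpa using hc2
  have hc1n : c1 ≠ 0 := by
    rintro rfl
    apply p1.2
    apply hinj
    simpa using hc1'
  have hc2n : c2 ≠ 0 := by
    rintro rfl
    apply p2.2
    simpa using hc2'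
  have hA : ∀ a b, a + b + 1 = d →
      wedgeDet d a b v2 v1 (fun _ => l1) * W.det = c1 * (-1) ^ (d - 1) * X 1 a := by
    intro a b hab
    rw [← wedge_mul]
    have s2 := wedge_tri hab v2 w v1
      (fun k => W.mulVec (v2 k)) w (fun _ => W.mulVec l1) (fun _ => 1) (fun _ => 1) (fun _ => c1)
      (fun k hk => htr2 k (by omega)) (fun k _ => hself w k) (fun k hk => by
        have : k = 0 := by omega
        subst this
        rw [hc1']; exact Submodule.zero_mem _)
    rw [← hw, s2]
    let u : ℕ → Fin d → ℂ := fun i => if i < a then v2 i else w (i - a)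
    have s4 : wedgeDet d a b v2 w v1 = wedgeDet d (d - 1) 1 u v1 v1 := by
      apply wedge_congr
      intro i hi
      by_cases q1 : i < a
      · rw [if_pos q1, if_pos (by omega)]; simp [u, q1]
      by_cases q2 : i < a + b
      · rw [if_neg q1, if_pos q2, if_pos (by omega)]; simp [u, q1]
      · rw [if_neg q1, if_neg q2, if_neg (by omega), if_pos (by omega)]
        congr 1; omega
    have s5 : wedgeDet d 1 (d - 1) v1 u v1 = X 1 a := by
      apply wedge_congr
      intro i hi
      by_cases q1 : i < 1
      · simp [q1]
      by_cases q2 : i < 1 + a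
      · rw [if_neg q1, if_neg q1, if_pos q2, if_pos (by omega)]
        simp only [u]; rw [if_pos (by omega)]
      · rw [if_neg q1, if_neg q1, if_neg q2, if_pos (by omega)]
        simp only [u]; rw [if_neg (by omega)]
    rw [s4, wedge_swap (by omega) v1 u v1, s5]
    simp [mul_assoc]
  have hB : ∀ a b, a + b + 1 = d →
      wedgeDet d a b v2 v1 (fun _ => l2) = c2 * (-1) ^ (a * b) * X b a := by
    intro a b hab
    have s2 := wedge_tri hab v2 v1 w
      v2 v1 (fun _ => l2) (fun _ => 1) (fun _ => 1) (fun _ => c2)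
      (fun k _ => hself v2 k) (fun k _ => hself v1 k) (fun k hk => by
        have : k = 0 := by omega
        subst this
        rw [hc2']; exact Submodule.zero_mem _)
    rw [s2, wedge_swap (by omega) v1 v2 w, mul_comm b a]
    simp [mul_assoc, hXdef]
  rintro ⟨i1, i2⟩ ⟨q1, q2, q3⟩
  simp only [] at q1 q2 q3 ⊢
  obtain ⟨b, rfl⟩ : ∃ b, i1 = b + 1 := ⟨i1 - 1, by omega⟩
  obtain ⟨n, rfl⟩ : ∃ n, i2 = n + 1 := ⟨i2 - 1, by omega⟩
  have core := algebra_core q3 q2 X W.det hdet hX hrel hsym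
  simp only [Nat.add_sub_cancel] at core ⊢
  have A1 := hA (b + 1) n (by omega)
  have A2 := hA b (n + 1) (by omega)
  rw [hB (b + 1) n (by omega), hB b (n + 1) (by omega)]
  have e1 := eq_div_of_mul_eq hdet A1
  have e2 := eq_div_of_mul_eq hdet A2
  rw [e1, e2]
  have m1 := hX n (b + 1) (by omega)
  have m2 := hX 1 b (by omega)
  have g1 : ((-1 : ℂ)) ^ ((b + 1) * n) * (-1) ^ ((b + 1) * n) = 1 := by
    rw [← mul_pow]; simp
  have g2 : ((-1 : ℂ)) ^ (b * (n + 1)) * (-1) ^ (d - 1) = - (-1) ^ ((b + 1) * n) := by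
    have : b * (n + 1) + (d - 1) = (b + 1) * n + 1 + 2 * b := by
      rw [← q3, show b + 1 + (n + 1) - 1 = b + n + 1 by omega]; ring
    rw [← pow_add, this, pow_add, pow_mul, pow_succ]
    simp
  rw [neg_eq_iff_eq_neg, div_eq_iff (by simp [hc1n, hc2n, m1, m2, hdet])]
  field_simp
  linear_combination ((-1 : ℂ)) ^ (b * (n + 1)) * core + (X n (b + 1) * X 1 b) * g2
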